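/- For every integer k with 1 ≤ k ≤ d, the set W_d^k has exactly 2^k − 1 elements and the point p(W_d^k), whose first d−k coordinates are equal to 0 and whose last k coordinates are equal to 2^{k−1}, is a canonical vertex of the White Whale H_∞^+(d,1); in particular p(W_d^k) is a vertex that is the sum of exactly 2^k − 1 generators. -/

import Mathlib

/-- The set `G_d` of generators of the White Whale:
all nonzero 0/1-valued vectors of `ℝ^d`. -/
def whaleGens (d : ℕ) : Set (Fin d → ℝ) :=
  {g | g ≠ 0 ∧ ∀ i, g i = 0 ∨ g i = 1}

/-- The point `p(S)`: the sum of the vectors in `S` (with `p(∅) = 0`). -/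
noncomputable def whaleSum {d : ℕ} (S : Set (Fin d → ℝ)) : Fin d → ℝ :=
  ∑ᶠ g ∈ S, g

/-- The White Whale `H_∞^+(d,1)`: the convex hull of the points `p(S)`
over all subsets `S ⊆ G_d`. -/
noncomputable def whiteWhale (d : ℕ) : Set (Fin d → ℝ) :=
  convexHull ℝ {x | ∃ S : Set (Fin d → ℝ), S ⊆ whaleGens d ∧ x = whaleSum S}

/-- A vertex of the White Whale is an extreme point of it. -/
def IsWhaleVertex (d : ℕ) (x : Fin d → ℝ) : Prop :=
  x ∈ Set.extremePoints ℝ (whiteWhale d)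

/-- The set W_d^k: vectors of G_d whose first d−k coordinates are 0. -/
def whaleW (d k : ℕ) : Set (Fin d → ℝ) :=
  {g | g ∈ whaleGens d ∧ ∀ i : Fin d, (i : ℕ) < d - k → g i = 0}

open Finset in
/-- The generators vanishing outside `A` are the indicator vectors of the nonempty subsets of `A`. -/
theorem whaleGens_supported_eq {d : ℕ} (A : Finset (Fin d)) :
    {g | g ∈ whaleGens d ∧ ∀ i, i ∉ A → g i = 0} =
      (((A.powerset.erase ∅).image fun T i => if i ∈ T then (1 : ℝ) else 0 :
        Finset (Fin d → ℝ)) : Set (Fin d → ℝ)) := by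
  ext g
  simp only [Set.mem_ofPred_eq, coe_image, Set.mem_image, mem_coe, mem_erase, mem_powerset,
    whaleGens]
  constructor
  · rintro ⟨⟨hg, h01⟩, hA⟩
    have key : (fun i => if i ∈ univ.filter (fun i => g i = 1) then (1 : ℝ) else 0) = g := by
      ext i
      rcases h01 i with h | h <;> simp [h]
    refine ⟨univ.filter fun i => g i = 1, ⟨fun h => hg ?_, fun i hi => ?_⟩, key⟩
    · rw [← key, h]
      ext i
      simp
    · by_contra hi'
      simp [hA i hi'] at hi
  · rintro ⟨T, ⟨hT, hTA⟩, rfl⟩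
    refine ⟨⟨fun h => ?_, fun i => ?_⟩, fun i hi => if_neg fun h => hi (hTA h)⟩
    · obtain ⟨i, hi⟩ := nonempty_iff_ne_empty.2 hT
      simpa [hi] using congrFun h i
    · by_cases h : i ∈ T <;> simp [h]

theorem indicator_vector_injective (d : ℕ) :
    Function.Injective fun (T : Finset (Fin d)) (i : Fin d) => if i ∈ T then (1 : ℝ) else 0 := by
  intro S T h
  ext i
  have := congrFun h i
  by_cases hS : i ∈ S <;> by_cases hT : i ∈ T <;> simp_all

theorem whaleGens_finite (d : ℕ) : (whaleGens d).Finite := by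
  have h := whaleGens_supported_eq (Finset.univ : Finset (Fin d))
  simp only [Finset.mem_univ, not_true_eq_false, false_implies, implies_true, and_true,
    Set.ofPred_mem_eq] at h
  rw [h]
  exact Finset.finite_toSet _

open Finset in
theorem sum_indicator_vector_apply {d : ℕ} (A : Finset (Fin d)) (i : Fin d) :
    (∑ T ∈ A.powerset.erase ∅, fun j => if j ∈ T then (1 : ℝ) else 0) i =
      if i ∈ A then (2 : ℝ) ^ (#A - 1) else 0 := by
  rw [Finset.sum_apply, sum_erase _ (by simp), sum_boole]
  split_ifs with hi
  · have : A.powerset.filter (fun T => i ∈ T) = Icc {i} A := by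
      ext T
      simp [and_comm]
    rw [this, card_Icc_finset (by simpa using hi)]
    simp
  · rw [filter_false_of_mem fun T hT h => hi (mem_powerset.1 hT h)]
    simp

/-- A point of `X` that strictly maximizes a linear functional over `X` is an extreme point of the
convex hull of `X`. -/
theorem mem_extremePoints_convexHull_of_forall_lt {E : Type*} [AddCommGroup E] [Module ℝ E]
    {X : Set E} {x : E} (hx : x ∈ X) (l : E →ₗ[ℝ] ℝ) (h : ∀ y ∈ X, y ≠ x → l y < l x) :
    x ∈ (convexHull ℝ X).extremePoints ℝ := by
  have hC : Convex ℝ {y | y = x ∨ l y < l x} := by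
    rintro y hy z hz a b ha hb hab
    by_cases hyz : y = x ∧ z = x
    · left
      rw [hyz.1, hyz.2, ← add_smul, hab, one_smul]
    rcases ha.eq_or_lt with rfl | ha
    · obtain rfl : b = 1 := by linarith
      simpa using hz
    rcases hb.eq_or_lt with rfl | hb
    · obtain rfl : a = 1 := by linarith
      simpa using hy
    right
    obtain rfl : b = 1 - a := by linarith
    simp only [map_add, map_smul, smul_eq_mul]
    rcases hy with rfl | hy <;> rcases hz with rfl | hz
    · exact absurd ⟨rfl, rfl⟩ hyz
    all_goals nlinarith
  have hsub : convexHull ℝ X ⊆ {y | y = x ∨ l y < l x} :=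
    convexHull_min (fun y hy => or_iff_not_imp_left.2 (h y hy)) hC
  refine mem_extremePoints.2 ⟨subset_convexHull ℝ X hx, ?_⟩
  rintro y hy z hz ⟨a, b, ha, hb, hab, hxe⟩
  have hl := congrArg l hxe
  simp only [map_add, map_smul, smul_eq_mul] at hl
  obtain rfl : b = 1 - a := by linarith
  rcases hsub hy with h1 | h1 <;> rcases hsub hz with h2 | h2
  · exact ⟨h1, h2⟩
  all_goals
    exfalso
    try rw [h1] at hl
    try rw [h2] at hl
    nlinarith

open Finset in
/-- If a linear functional does not vanish on any generator, then the sum of the generators on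
which it is positive is a vertex of the White Whale. -/
theorem isWhaleVertex_of_separating {d : ℕ} {W : Set (Fin d → ℝ)} (hW : W ⊆ whaleGens d)
    (l : (Fin d → ℝ) →ₗ[ℝ] ℝ) (hpos : ∀ g ∈ W, 0 < l g)
    (hneg : ∀ g ∈ whaleGens d, g ∉ W → l g < 0) :
    IsWhaleVertex d (whaleSum W) := by
  classical
  have hsum : ∀ S ⊆ whaleGens d,
      l (whaleSum S) = ∑ g ∈ (whaleGens_finite d).toFinset, if g ∈ S then l g else 0 := by
    intro S hS
    have hfin := (whaleGens_finite d).subset hS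
    rw [whaleSum, finsum_mem_eq_finite_toFinset_sum _ hfin, map_sum, ← sum_filter]
    refine sum_congr ?_ fun _ _ => rfl
    ext g
    simpa using fun h => hS h
  refine mem_extremePoints_convexHull_of_forall_lt ⟨W, hW, rfl⟩ l ?_
  rintro _ ⟨S, hS, rfl⟩ hne
  have hSW : S ≠ W := fun h => hne (h ▸ rfl)
  rw [hsum S hS, hsum W hW]
  refine sum_lt_sum (fun g hg => ?_) ?_
  · have hg' : g ∈ whaleGens d := by simpa using hg
    by_cases h1 : g ∈ S <;> by_cases h2 : g ∈ W <;> simp only [h1, h2, if_true, if_false, le_refl]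
    · exact (hneg g hg' h2).le
    · exact (hpos g h2).le
  · obtain ⟨g, hg⟩ : ∃ g, ¬(g ∈ S ↔ g ∈ W) := by
      by_contra! h
      exact hSW (Set.ext h)
    by_cases h1 : g ∈ S <;> by_cases h2 : g ∈ W <;> simp only [h1, h2, not_true, iff_self] at hg
    · exact ⟨g, by simpa using hS h1, by simpa [h1, h2] using hneg g (hS h1) h2⟩
    · exact ⟨g, by simpa using hW h2, by simpa [h1, h2] using hpos g h2⟩

open Finset in
/-- The sum of the generators vanishing outside `A` is a vertex of the White Whale. -/
theorem isWhaleVertex_supported {d : ℕ} (A : Finset (Fin d)) :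
    IsWhaleVertex d (whaleSum {g | g ∈ whaleGens d ∧ ∀ i, i ∉ A → g i = 0}) := by
  let c : Fin d → ℝ := fun i => if i ∈ A then 1 else -(d + 1)
  let l : (Fin d → ℝ) →ₗ[ℝ] ℝ := ∑ i, c i • LinearMap.proj i
  have hl : ∀ g, l g = ∑ i, c i * g i := fun g => by simp [l]
  refine isWhaleVertex_of_separating (fun g hg => hg.1) l ?_ ?_
  · rintro g ⟨⟨hg, h01⟩, hA⟩
    rw [hl]
    obtain ⟨i, hi⟩ := Function.ne_iff.1 hg
    refine sum_pos' (fun j _ => ?_) ⟨i, mem_univ i, ?_⟩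
    · by_cases hj : j ∈ A
      · rcases h01 j with h | h <;> simp [c, hj, h]
      · simp [hA j hj]
    · have hiA : i ∈ A := by
        by_contra h
        exact hi (hA i h)
      have : g i = 1 := (h01 i).resolve_left hi
      simp [c, hiA, this]
  · rintro g ⟨hg, h01⟩ hgW
    obtain ⟨i, hiA, hi⟩ : ∃ i, i ∉ A ∧ g i ≠ 0 := by
      by_contra! h
      exact hgW ⟨⟨hg, h01⟩, h⟩
    have hgi : g i = 1 := (h01 i).resolve_left hi
    have hrest : ∑ j ∈ univ.erase i, c j * g j ≤ ∑ j ∈ univ.erase i, (1 : ℝ) := by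
      refine sum_le_sum fun j _ => ?_
      have hd : (0 : ℝ) ≤ d := Nat.cast_nonneg d
      by_cases hj : j ∈ A <;> rcases h01 j with h | h <;> simp [c, hj, h]
      linarith
    have hcard : ∑ j ∈ univ.erase i, (1 : ℝ) ≤ d := by
      rw [sum_const, nsmul_one]
      exact_mod_cast (card_le_univ _).trans (Fintype.card_fin d).le
    rw [hl, ← add_sum_erase _ _ (mem_univ i)]
    simp only [c, hiA, if_false, hgi] at hrest ⊢
    linarith

/-- W_d^k has exactly 2^k − 1 elements and p(W_d^k), whose first d−k
coordinates are 0 and whose last k coordinates are 2^(k−1), is a canonical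
vertex of the White Whale. -/
theorem whaleW_sum_is_canonical_vertex (d k : ℕ) (hd : 1 ≤ d)
    (hk1 : 1 ≤ k) (hk2 : k ≤ d) :
    (whaleW d k).ncard = 2 ^ k - 1 ∧
    whaleSum (whaleW d k) =
      (fun i : Fin d => if (i : ℕ) < d - k then 0 else (2 : ℝ) ^ (k - 1)) ∧
    IsWhaleVertex d (whaleSum (whaleW d k)) ∧
    Monotone (whaleSum (whaleW d k)) := by
  obtain ⟨A, hA⟩ : ∃ A : Finset (Fin d), ∀ i, i ∈ A ↔ ¬(i : ℕ) < d - k :=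
    ⟨Finset.univ.filter fun i => ¬(i : ℕ) < d - k, fun i => by simp⟩
  have hcard : A.card = k := by
    have hmap : A.map Fin.valEmbedding = Finset.Ico (d - k) d := by
      ext n
      simp only [Finset.mem_map, Fin.valEmbedding_apply, Finset.mem_Ico]
      constructor
      · rintro ⟨i, hi, rfl⟩
        exact ⟨not_lt.1 ((hA i).1 hi), i.2⟩
      · rintro ⟨h1, h2⟩
        exact ⟨⟨n, h2⟩, (hA _).2 (not_lt.2 h1), rfl⟩
    rw [← Finset.card_map Fin.valEmbedding, hmap, Nat.card_Ico]
    omega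
  have hW : whaleW d k = {g | g ∈ whaleGens d ∧ ∀ i, i ∉ A → g i = 0} := by
    simp only [whaleW, hA, not_not]
  have hsum : whaleSum (whaleW d k) =
      (fun i : Fin d => if (i : ℕ) < d - k then 0 else (2 : ℝ) ^ (k - 1)) := by
    ext i
    rw [whaleSum, hW, whaleGens_supported_eq, finsum_mem_coe_finset,
      Finset.sum_image (indicator_vector_injective d).injOn, sum_indicator_vector_apply, hcard]
    simp only [hA, ite_not]
  refine ⟨?_, hsum, hW ▸ isWhaleVertex_supported A, ?_⟩
  · rw [hW, whaleGens_supported_eq, Set.ncard_coe_finset,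
      Finset.card_image_of_injective _ (indicator_vector_injective d),
      Finset.card_erase_of_mem (Finset.empty_mem_powerset A), Finset.card_powerset, hcard]
  · rw [hsum]
    intro i j hij
    have hij' : (i : ℕ) ≤ j := hij
    dsimp only
    split_ifs
    · exact le_rfl
    · positivity
    · omega
    · exact le_rfl
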